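/- arXiv:math/0408245 — 11 statements merged into one kernel-verified Lean document; each statement's English description precedes it below -/
import Mathlib

section
/- Let L be a Lie algebra over ℝ, G : L → L a bijective linear map, and F ⊆ L a linear subspace such that: (i) [F, F] ⊆ F; (ii) [G(F), G(F)] ⊆ G(F); (iii) there exist pairwise distinct nonzero real numbers t_1, …, t_p such that [(G − t_r·Id)(F), (G − t_r·Id)(F)] ⊆ (G − t_r·Id)(F) for every r = 1, …, p; and (iv) ⋂_{r=1}^p (G − t_r·Id)(F) = {0}. Then the Nijenhuis torsion of G vanishes on F, i.e. N_G(u, v) = 0 for all u, v ∈ F. -/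
/-- The Nijenhuis torsion of a linear map `G` on a Lie algebra:
`N_G(u, v) = [G u, G v] − G([G u, v] + [u, G v]) + G²[u, v]`. -/
def nijenhuisTorsion {L : Type*} [LieRing L] [LieAlgebra ℝ L]
    (G : L →ₗ[ℝ] L) (u v : L) : L :=
  ⁅G u, G v⁆ - G (⁅G u, v⁆ + ⁅u, G v⁆) + G (G ⁅u, v⁆)

/-- If `F` is bracket-closed, `G(F)` is bracket-closed, the images
`(G − t_r·Id)(F)` are bracket-closed for pairwise distinct nonzero reals `t_1, …, t_p`
whose associated images intersect trivially, then the Nijenhuis torsion of `G`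
vanishes on `F`. -/
theorem nijenhuis_vanishes_on_F {L : Type*} [LieRing L] [LieAlgebra ℝ L]
    (G : L →ₗ[ℝ] L) (hG : Function.Bijective G) (F : Submodule ℝ L)
    (hF : ∀ u ∈ F, ∀ v ∈ F, ⁅u, v⁆ ∈ F)
    (hGF : ∀ u ∈ F.map G, ∀ v ∈ F.map G, ⁅u, v⁆ ∈ F.map G)
    (p : ℕ) (t : Fin p → ℝ) (ht : Function.Injective t) (ht0 : ∀ r, t r ≠ 0)
    (htF : ∀ r : Fin p,
      ∀ u ∈ F.map (G - t r • (LinearMap.id : L →ₗ[ℝ] L)),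
      ∀ v ∈ F.map (G - t r • (LinearMap.id : L →ₗ[ℝ] L)),
        ⁅u, v⁆ ∈ F.map (G - t r • (LinearMap.id : L →ₗ[ℝ] L)))
    (hcap : ⨅ r : Fin p, F.map (G - t r • (LinearMap.id : L →ₗ[ℝ] L)) = ⊥) :
    ∀ u ∈ F, ∀ v ∈ F, nijenhuisTorsion G u v = 0 := by
  intro u hu v hv
  obtain ⟨w0, hw0, h0⟩ := hGF _ (Submodule.mem_map_of_mem hu) _ (Submodule.mem_map_of_mem hv)
  have hM : w0 - (⁅G u, v⁆ + ⁅u, G v⁆) + G ⁅u, v⁆ ∈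
      ⨅ r : Fin p, F.map (G - t r • (LinearMap.id : L →ₗ[ℝ] L)) := by
    rw [Submodule.mem_iInf]
    intro r
    obtain ⟨w, hw, h1⟩ := htF r _ (Submodule.mem_map_of_mem hu) _ (Submodule.mem_map_of_mem hv)
    rw [← Submodule.smul_mem_iff _ (ht0 r)]
    refine ⟨w - w0 + t r • ⁅u, v⁆,
      F.add_mem (F.sub_mem hw hw0) (F.smul_mem _ (hF u hu v hv)), ?_⟩
    rw [map_add, map_sub, h1]
    simp only [LinearMap.sub_apply, LinearMap.smul_apply, LinearMap.id_apply, map_smul,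
      sub_lie, lie_sub, smul_lie, lie_smul, h0]
    rw [← h0]
    module
  rw [hcap, Submodule.mem_bot] at hM
  have := congrArg G hM
  rw [map_add, map_sub, h0, map_zero] at this
  exact this
end

section
/- Let L be a Lie algebra over ℝ, G : L → L a bijective linear map, and F ⊆ L a linear subspace such that [F, F] ⊆ F, [G(F), G(F)] ⊆ G(F), and N_G(u, v) = 0 for all u, v ∈ F. Then for every real number t one has [(G − t·Id)(F), (G − t·Id)(F)] ⊆ (G − t·Id)(F). -/
/-- If `F` is bracket-closed, `G(F)` is bracket-closed, and the Nijenhuis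
torsion of `G` vanishes on `F`, then `(G − t·Id)(F)` is bracket-closed for every real `t`. -/
theorem pencil_bracket_closed {L : Type*} [LieRing L] [LieAlgebra ℝ L]
    (G : L →ₗ[ℝ] L) (hG : Function.Bijective G) (F : Submodule ℝ L)
    (hF : ∀ u ∈ F, ∀ v ∈ F, ⁅u, v⁆ ∈ F)
    (hGF : ∀ u ∈ F.map G, ∀ v ∈ F.map G, ⁅u, v⁆ ∈ F.map G)
    (hN : ∀ u ∈ F, ∀ v ∈ F, nijenhuisTorsion G u v = 0) :
    ∀ t : ℝ,
      ∀ u ∈ F.map (G - t • (LinearMap.id : L →ₗ[ℝ] L)),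
      ∀ v ∈ F.map (G - t • (LinearMap.id : L →ₗ[ℝ] L)),
        ⁅u, v⁆ ∈ F.map (G - t • (LinearMap.id : L →ₗ[ℝ] L)) := by
  rintro t _ ⟨u, hu, rfl⟩ _ ⟨v, hv, rfl⟩
  obtain ⟨w, hw, hwe⟩ := hGF (G u) ⟨u, hu, rfl⟩ (G v) ⟨v, hv, rfl⟩
  have hn := hN u hu v hv
  unfold nijenhuisTorsion at hn
  have hw2 : w = ⁅G u, v⁆ + ⁅u, G v⁆ - G ⁅u, v⁆ := by
    apply hG.1
    rw [hwe, map_sub]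
    rw [← sub_eq_zero, ← hn]
    abel
  refine ⟨w - t • ⁅u, v⁆, F.sub_mem hw (F.smul_mem t (hF u hu v hv)), ?_⟩
  simp only [LinearMap.sub_apply, LinearMap.smul_apply, LinearMap.id_apply, map_sub, map_smul,
    sub_lie, lie_sub, smul_lie, lie_smul, hwe]
  rw [hw2]
  module
end

section
/- Let t_1, …, t_p be pairwise distinct real numbers with t_1 = 0 and t_2 = 1, and let t'_1, …, t'_p be pairwise distinct real numbers with t'_1 = 0 and t'_2 = 1. Define β(t) = span{(t_p − t)e_p^j − (t_k − t)e_k^j : k = 1, …, p−1, j = 1, …, c} and β'(t) = span{(t'_p − t)e_p^j − (t'_k − t)e_k^j : k = 1, …, p−1, j = 1, …, c}. Then β and β' have the same image (i.e. for every t ∈ ℝ there exists t' ∈ ℝ with β(t) = β'(t'), and conversely) if and only if t_k = t'_k for every k = 1, …, p. -/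
noncomputable section

/-- The `pc`-dimensional real vector space (paper `p` is `p+2 ≥ 2`, paper `c` is `c+1 ≥ 1`). -/
abbrev V (p c : ℕ) : Type := Fin (p + 2) × Fin (c + 1) → ℝ

/-- The basis vector `e_i^j`. -/
def e (p c : ℕ) (i : Fin (p + 2)) (j : Fin (c + 1)) : V p c := Pi.single (i, j) 1

/-- The last block index, i.e. paper index `p`. -/
def lastB (p : ℕ) : Fin (p + 2) := Fin.last (p + 1)

/-- `F_i = span{e_k^j : k ≠ i, j = 1,…,c}`. -/
def Fsub (p c : ℕ) (i : Fin (p + 2)) : Submodule ℝ (V p c) :=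
  Submodule.span ℝ {v | ∃ k, k ≠ i ∧ ∃ j, v = e p c k j}

/-- `F_{p+1} = span{e_p^j − e_k^j : k = 1,…,p−1, j = 1,…,c}`. -/
def Flast (p c : ℕ) : Submodule ℝ (V p c) :=
  Submodule.span ℝ {v | ∃ k, k ≠ lastB p ∧ ∃ j, v = e p c (lastB p) j - e p c k j}

/-- The pencil `β(s) = span{(t_p − s)e_p^j − (t_k − s)e_k^j : k = 1,…,p−1, j = 1,…,c}`. -/
def pencil (p c : ℕ) (t : Fin (p + 2) → ℝ) (s : ℝ) : Submodule ℝ (V p c) :=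
  Submodule.span ℝ
    {v | ∃ k, k ≠ lastB p ∧ ∃ j,
      v = (t (lastB p) - s) • e p c (lastB p) j - (t k - s) • e p c k j}

/-- The functional killing the pencil at a generic parameter. -/
def phi (p c : ℕ) (t : Fin (p + 2) → ℝ) (s : ℝ) : V p c →ₗ[ℝ] ℝ :=
  ∑ k, (t k - s)⁻¹ • LinearMap.proj (k, (0 : Fin (c + 1)))

theorem phi_e (p c : ℕ) (t : Fin (p + 2) → ℝ) (s : ℝ) (k : Fin (p + 2)) (j : Fin (c + 1)) :
    phi p c t s (e p c k j) = if j = 0 then (t k - s)⁻¹ else 0 := by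
  simp only [phi, e, LinearMap.sum_apply, LinearMap.smul_apply, LinearMap.proj_apply, smul_eq_mul]
  rw [Finset.sum_eq_single k]
  · by_cases hj : j = 0
    · simp [hj]
    · simp [hj, Pi.single_apply, Ne.symm hj]
  · intro b _ hb
    simp [Pi.single_apply, hb]
  · simp

theorem pencil_le_ker (p c : ℕ) (t : Fin (p + 2) → ℝ) (s : ℝ) (hs : ∀ k, t k - s ≠ 0) :
    pencil p c t s ≤ LinearMap.ker (phi p c t s) := by
  refine Submodule.span_le.2 ?_
  rintro v ⟨k, hk, j, rfl⟩
  simp only [SetLike.mem_coe, LinearMap.mem_ker, map_sub, map_smul, phi_e, smul_eq_mul]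
  by_cases hj : j = 0
  · simp [hj, hs]
  · simp [hj]

/-- uniqueness lemma: two pencils normalized by `t_1 = t'_1 = 0` and
`t_2 = t'_2 = 1` have the same image iff `t_k = t'_k` for every `k`. -/
theorem pencil_same_image_iff (p c : ℕ) (t t' : Fin (p + 2) → ℝ)
    (ht : Function.Injective t) (ht' : Function.Injective t')
    (h0 : t 0 = 0) (h1 : t 1 = 1) (h0' : t' 0 = 0) (h1' : t' 1 = 1) :
    ((∀ s : ℝ, ∃ s' : ℝ, pencil p c t s = pencil p c t' s') ∧
        (∀ s' : ℝ, ∃ s : ℝ, pencil p c t' s' = pencil p c t s)) ↔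
      t = t' := by
  constructor
  · rintro ⟨h, -⟩
    obtain ⟨s, hs⟩ := (Set.finite_range t).exists_notMem
    have hs : ∀ k, t k - s ≠ 0 := fun k hk => hs ⟨k, by linarith⟩
    obtain ⟨s', hs'⟩ := h s
    obtain ⟨l, hl⟩ : ∃ l : ℝ, ∀ k, t' k - s' = l * (t k - s) := by
      refine ⟨(t' (lastB p) - s') * (t (lastB p) - s)⁻¹, fun k => ?_⟩
      by_cases hk : k = lastB p
      · subst hk
        rw [mul_assoc, inv_mul_cancel₀ (hs _), mul_one]
      · have hm : (t' (lastB p) - s') • e p c (lastB p) 0 - (t' k - s') • e p c k 0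
            ∈ pencil p c t s := by
          rw [hs']
          exact Submodule.subset_span ⟨k, hk, 0, rfl⟩
        have h2 := pencil_le_ker p c t s hs hm
        simp only [LinearMap.mem_ker, map_sub, map_smul, phi_e, smul_eq_mul, if_true] at h2
        rw [sub_eq_zero.1 h2, mul_assoc, inv_mul_cancel₀ (hs _), mul_one]
    have a := hl 0
    have b := hl 1
    rw [h0, h0'] at a
    rw [h1, h1'] at b
    have hl1 : l = 1 := by linarith
    subst hl1
    funext k
    have := hl k
    linarith
  · rintro rfl
    exact ⟨fun s => ⟨s, rfl⟩, fun s => ⟨s, rfl⟩⟩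
end
end

section
/- Let L be a Lie algebra over ℝ whose underlying vector space is a direct sum L = H_1 ⊕ … ⊕ H_p of subspaces satisfying [H_i, H_i] ⊆ H_i for every i and [H_i, H_j] ⊆ H_i + H_j for all i ≠ j. Let t_1, …, t_p be real numbers and let G : L → L be the linear map which equals t_i·Id in restriction to each H_i. Then the Nijenhuis torsion of G vanishes identically: N_G(u, v) = 0 for all u, v ∈ L. -/
/-- if `L = H_1 ⊕ … ⊕ H_p` with `[H_i, H_i] ⊆ H_i` and
`[H_i, H_j] ⊆ H_i + H_j` for `i ≠ j`, and `G` is the linear map equal to `t_i·Id` on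
each `H_i`, then the Nijenhuis torsion of `G` vanishes identically. -/
theorem nijenhuis_vanishes_of_diagonal {L : Type*} [LieRing L] [LieAlgebra ℝ L]
    (p : ℕ) (H : Fin p → Submodule ℝ L) (hdec : DirectSum.IsInternal H)
    (hHi : ∀ i, ∀ u ∈ H i, ∀ v ∈ H i, ⁅u, v⁆ ∈ H i)
    (hHij : ∀ i j, i ≠ j → ∀ u ∈ H i, ∀ v ∈ H j, ⁅u, v⁆ ∈ H i ⊔ H j)
    (t : Fin p → ℝ) (G : L →ₗ[ℝ] L) (hG : ∀ i, ∀ u ∈ H i, G u = t i • u) :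
    ∀ u v : L, nijenhuisTorsion G u v = 0 := by
  have key : ∀ i j, ∀ u ∈ H i, ∀ v ∈ H j, nijenhuisTorsion G u v = 0 := by
    intro i j u hu v hv
    have hab : ⁅u, v⁆ ∈ H i ⊔ H j := by
      by_cases hij : i = j
      · subst hij
        exact Submodule.mem_sup_left (hHi i u hu v hv)
      · exact hHij i j hij u hu v hv
    obtain ⟨a, ha, b, hb, hs⟩ := Submodule.mem_sup.mp hab
    simp only [nijenhuisTorsion, hG i u hu, hG j v hv, smul_lie, lie_smul, ← hs, map_add,
      map_smul, hG i a ha, hG j b hb]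
    module
  have htop : ∀ w : L, w ∈ ⨆ i, H i := by
    intro w
    rw [hdec.submodule_iSup_eq_top]
    trivial
  intro u v
  refine Submodule.iSup_induction H (motive := fun u => nijenhuisTorsion G u v = 0) (htop u)
    (fun i x hx => ?_) ?_ ?_
  · refine Submodule.iSup_induction H (motive := fun v => nijenhuisTorsion G x v = 0) (htop v)
      (fun j y hy => key i j x hx y hy) ?_ ?_
    · simp [nijenhuisTorsion]
    · intro y z hy hz
      have : nijenhuisTorsion G x (y + z) = nijenhuisTorsion G x y + nijenhuisTorsion G x z := by
        simp only [nijenhuisTorsion, map_add, lie_add]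
        abel
      rw [this, hy, hz, add_zero]
  · simp [nijenhuisTorsion]
  · intro y z hy hz
    have : nijenhuisTorsion G (y + z) v = nijenhuisTorsion G y v + nijenhuisTorsion G z v := by
      simp only [nijenhuisTorsion, map_add, add_lie]
      abel
    rw [this, hy, hz, add_zero]
end

section
/- The linear map G : V → V defined by G(e_i^j) = t_i e_i^j satisfies (G − t_i·Id)(F_{p+1}) = F_i for every i = 1, …, p. -/
noncomputable section

/-- the linear map `G` with `G(e_i^j) = t_i e_i^j` satisfies
`(G − t_i·Id)(F_{p+1}) = F_i` for every `i = 1, …, p`. -/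
theorem diagonal_map_interpolates (p c : ℕ) (t : Fin (p + 2) → ℝ)
    (ht : Function.Injective t)
    (G : V p c →ₗ[ℝ] V p c) (hG : ∀ i j, G (e p c i j) = t i • e p c i j) :
    ∀ i : Fin (p + 2),
      (Flast p c).map (G - t i • (LinearMap.id : V p c →ₗ[ℝ] V p c)) = Fsub p c i := by
  intro i
  have hA : ∀ k j, (G - t i • (LinearMap.id : V p c →ₗ[ℝ] V p c)) (e p c k j)
      = (t k - t i) • e p c k j := by
    intro k j
    simp [hG, sub_smul]
  have hB : ∀ k j, (t k - t i) • e p c k j ∈ Fsub p c i := by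
    intro k j
    by_cases h : k = i
    · subst h
      simp
    · exact Submodule.smul_mem _ _ (Submodule.subset_span ⟨k, h, j, rfl⟩)
  have hC : ∀ k j, e p c (lastB p) j - e p c k j ∈ Flast p c := by
    intro k j
    by_cases h : k = lastB p
    · subst h
      simp
    · exact Submodule.subset_span ⟨k, h, j, rfl⟩
  apply le_antisymm
  · rw [Flast, Submodule.map_span_le]
    rintro v ⟨k, _, j, rfl⟩
    rw [map_sub, hA, hA]
    exact Submodule.sub_mem _ (hB _ _) (hB _ _)
  · rw [Fsub, Submodule.span_le]
    rintro v ⟨k, hk, j, rfl⟩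
    have hne : t k - t i ≠ 0 := sub_ne_zero.mpr (fun h => hk (ht h))
    refine ⟨(t k - t i)⁻¹ • ((e p c (lastB p) j - e p c i j) - (e p c (lastB p) j - e p c k j)),
      Submodule.smul_mem _ _ (Submodule.sub_mem _ (hC _ _) (hC _ _)), ?_⟩
    rw [map_smul, map_sub, map_sub, map_sub, hA, hA, hA, sub_self, zero_smul, sub_zero,
      sub_sub_cancel, smul_smul, inv_mul_cancel₀ hne, one_smul]
end
end

section
/- Let G' : V → V be any linear map satisfying (G' − t_i·Id)(F_{p+1}) = F_i for every i = 1, …, p. Then G'(e_p^j − e_k^j) = t_p e_p^j − t_k e_k^j for every k = 1, …, p−1 and every j = 1, …, c. -/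
noncomputable section

/-- any linear map `G'` with `(G' − t_i·Id)(F_{p+1}) = F_i` for all `i`
satisfies `G'(e_p^j − e_k^j) = t_p e_p^j − t_k e_k^j` for every `k ≠ p` and every `j`. -/
theorem interpolating_map_determined (p c : ℕ) (t : Fin (p + 2) → ℝ)
    (ht : Function.Injective t)
    (G' : V p c →ₗ[ℝ] V p c)
    (hG' : ∀ i : Fin (p + 2),
      (Flast p c).map (G' - t i • (LinearMap.id : V p c →ₗ[ℝ] V p c)) = Fsub p c i) :
    ∀ k, k ≠ lastB p → ∀ j,
      G' (e p c (lastB p) j - e p c k j) =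
        t (lastB p) • e p c (lastB p) j - t k • e p c k j := by
  intro k hk j
  have hF : ∀ i : Fin (p + 2), ∀ v ∈ Fsub p c i, ∀ l, v (i, l) = 0 := by
    intro i v hv l
    unfold Fsub at hv
    induction hv using Submodule.span_induction with
    | mem x hx =>
      obtain ⟨m, hm, n, rfl⟩ := hx
      simp [e, Pi.single_apply, hm.symm]
    | zero => simp
    | add x y _ _ hx hy => simp [hx, hy]
    | smul a x _ hx => simp [hx]
  have hv : e p c (lastB p) j - e p c k j ∈ Flast p c :=
    Submodule.subset_span ⟨k, hk, j, rfl⟩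
  ext ⟨i, l⟩
  have h1 : (G' - t i • (LinearMap.id : V p c →ₗ[ℝ] V p c))
      (e p c (lastB p) j - e p c k j) ∈ Fsub p c i := by
    rw [← hG' i]
    exact Submodule.mem_map_of_mem hv
  have h2 := hF i _ h1 l
  simp only [LinearMap.sub_apply, LinearMap.smul_apply, LinearMap.id_apply, Pi.sub_apply,
    Pi.smul_apply, smul_eq_mul] at h2 ⊢
  have key : ∀ m, t i * e p c m j (i, l) = t m * e p c m j (i, l) := by
    intro m
    by_cases h : i = m
    · rw [h]
    · simp [e, Pi.single_apply, h]
  have a := key (lastB p)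
  have b := key k
  linarith
end
end

section
/- Let G : V → V be the linear map defined by G(e_i^j) = t_i e_i^j, and let G' : V → V be any linear map satisfying (G' − t_i·Id)(F_{p+1}) = F_i for every i = 1, …, p. Then (G' − t·Id)(F_{p+1}) = (G − t·Id)(F_{p+1}) for every t ∈ ℝ; that is, G' defines the same pencil as G. -/
noncomputable section

/-- any linear map `G'` interpolating `(G' − t_i·Id)(F_{p+1}) = F_i`
defines the same pencil as the diagonal map `G(e_i^j) = t_i e_i^j`. -/
theorem interpolating_pencil_unique (p c : ℕ) (t : Fin (p + 2) → ℝ)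
    (ht : Function.Injective t)
    (G : V p c →ₗ[ℝ] V p c) (hG : ∀ i j, G (e p c i j) = t i • e p c i j)
    (G' : V p c →ₗ[ℝ] V p c)
    (hG' : ∀ i : Fin (p + 2),
      (Flast p c).map (G' - t i • (LinearMap.id : V p c →ₗ[ℝ] V p c)) = Fsub p c i) :
    ∀ s : ℝ,
      (Flast p c).map (G' - s • (LinearMap.id : V p c →ₗ[ℝ] V p c)) =
        (Flast p c).map (G - s • (LinearMap.id : V p c →ₗ[ℝ] V p c)) := by
  have hF : ∀ (i : Fin (p + 2)) (j : Fin (c + 1)), ∀ w ∈ Fsub p c i, w (i, j) = 0 := by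
    intro i j w hw
    have hle : Fsub p c i ≤ LinearMap.ker (LinearMap.proj (R := ℝ) (φ := fun _ => ℝ) (i, j)) := by
      unfold Fsub
      rw [Submodule.span_le]
      rintro v ⟨k, hk, l, rfl⟩
      have hne : (i, j) ≠ (k, l) := fun h => hk (congrArg Prod.fst h).symm
      simp only [SetLike.mem_coe, LinearMap.mem_ker, LinearMap.proj_apply, e]
      exact Pi.single_eq_of_ne hne 1
    exact hle hw
  have hGc : ∀ (v : V p c) (i : Fin (p + 2)) (j : Fin (c + 1)),
      (G v) (i, j) = t i * v (i, j) := by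
    intro v i j
    have hlin : (LinearMap.proj (R := ℝ) (φ := fun _ => ℝ) (i, j)) ∘ₗ G
        = t i • (LinearMap.proj (R := ℝ) (φ := fun _ => ℝ) (i, j)) := by
      apply (Pi.basisFun ℝ (Fin (p + 2) × Fin (c + 1))).ext
      rintro ⟨k, l⟩
      have h := hG k l
      unfold e at h
      simp only [Pi.basisFun_apply, LinearMap.comp_apply, h, LinearMap.smul_apply,
        LinearMap.proj_apply, Pi.smul_apply, smul_eq_mul]
      by_cases hk : k = i
      · rw [hk]
      · have hne : (i, j) ≠ (k, l) := fun h => hk (congrArg Prod.fst h).symm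
        rw [Pi.single_eq_of_ne hne]; simp
    exact LinearMap.congr_fun hlin v
  have key : ∀ v ∈ Flast p c, G' v = G v := by
    intro v hv
    ext ⟨i, j⟩
    have h := hF i j _ (hG' i ▸ Submodule.mem_map_of_mem hv)
    simp only [LinearMap.sub_apply, LinearMap.smul_apply, LinearMap.id_apply, Pi.sub_apply,
      Pi.smul_apply, smul_eq_mul] at h
    rw [hGc]
    linarith
  intro s
  ext w
  simp only [Submodule.mem_map, LinearMap.sub_apply]
  constructor
  · rintro ⟨v, hv, rfl⟩
    exact ⟨v, hv, by rw [key v hv]⟩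
  · rintro ⟨v, hv, rfl⟩
    exact ⟨v, hv, by rw [key v hv]⟩
end
end

section
/- A linear map G' : V → V satisfies (G' − t_i·Id)(F_{p+1}) = F_i for every i = 1, …, p if and only if there exist vectors v^1, …, v^c ∈ V such that G'(e_k^j) = t_k e_k^j + v^j for every k = 1, …, p and j = 1, …, c. -/
noncomputable section

theorem e_sub_mem (p c : ℕ) (k : Fin (p + 2)) (j : Fin (c + 1)) :
    e p c (lastB p) j - e p c k j ∈ Flast p c := by
  by_cases h : k = lastB p
  · subst h; simp
  · exact Submodule.subset_span ⟨k, h, j, rfl⟩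

theorem e_sub_mem' (p c : ℕ) (a b : Fin (p + 2)) (j : Fin (c + 1)) :
    e p c a j - e p c b j ∈ Flast p c := by
  have := (Flast p c).sub_mem (e_sub_mem p c b j) (e_sub_mem p c a j)
  simpa using this

theorem Fsub_apply (p c : ℕ) (i : Fin (p + 2)) (x : V p c) (hx : x ∈ Fsub p c i)
    (j : Fin (c + 1)) : x (i, j) = 0 := by
  have h : Fsub p c i ≤ LinearMap.ker (LinearMap.proj (R := ℝ) (φ := fun _ => ℝ) (i, j)) := by
    refine Submodule.span_le.2 ?_
    rintro _ ⟨k, hk, l, rfl⟩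
    simp [e, Pi.single_apply, hk.symm]
  simpa using h hx

theorem smul_e_mem (p c : ℕ) (t : Fin (p + 2) → ℝ) (i k : Fin (p + 2)) (j : Fin (c + 1)) :
    (t k - t i) • e p c k j ∈ Fsub p c i := by
  by_cases h : k = i
  · subst h; simp
  · exact Submodule.smul_mem _ _ (Submodule.subset_span ⟨k, h, j, rfl⟩)

/-- a linear map `G'` satisfies `(G' − t_i·Id)(F_{p+1}) = F_i` for all `i`
iff there are vectors `v^1, …, v^c` with `G'(e_k^j) = t_k e_k^j + v^j` for all `k, j`. -/
theorem interpolating_maps_characterized (p c : ℕ) (t : Fin (p + 2) → ℝ)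
    (ht : Function.Injective t) (G' : V p c →ₗ[ℝ] V p c) :
    (∀ i : Fin (p + 2),
        (Flast p c).map (G' - t i • (LinearMap.id : V p c →ₗ[ℝ] V p c)) = Fsub p c i) ↔
      ∃ v : Fin (c + 1) → V p c,
        ∀ k j, G' (e p c k j) = t k • e p c k j + v j := by
  constructor
  · intro H
    refine ⟨fun j => G' (e p c (lastB p) j) - t (lastB p) • e p c (lastB p) j, fun k j => ?_⟩
    have key : ∀ x, G' (e p c (lastB p) j - e p c k j) x
        = t x.1 * (e p c (lastB p) j - e p c k j) x := by
      rintro ⟨i, l⟩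
      have h1 := Submodule.mem_map_of_mem
        (f := G' - t i • (LinearMap.id : V p c →ₗ[ℝ] V p c)) (e_sub_mem p c k j)
      rw [H i] at h1
      have h2 := Fsub_apply p c i _ h1 l
      rw [LinearMap.sub_apply, LinearMap.smul_apply, LinearMap.id_apply, Pi.sub_apply,
        Pi.smul_apply, smul_eq_mul] at h2
      linarith
    have ev : ∀ (a : Fin (p + 2)) x, t x.1 * e p c a j x = t a * e p c a j x := by
      rintro a ⟨i, l⟩
      by_cases h : i = a
      · subst h; rfl
      · simp [e, Pi.single_apply, h]
    funext x
    have h := key x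
    rw [map_sub, Pi.sub_apply, Pi.sub_apply, mul_sub, ev, ev] at h
    simp only [Pi.add_apply, Pi.sub_apply, Pi.smul_apply, smul_eq_mul]
    linarith
  · rintro ⟨v, hv⟩ i
    have key : ∀ a b j, (G' - t i • (LinearMap.id : V p c →ₗ[ℝ] V p c))
        (e p c a j - e p c b j) = (t a - t i) • e p c a j - (t b - t i) • e p c b j := by
      intro a b j
      simp only [LinearMap.sub_apply, LinearMap.smul_apply, LinearMap.id_apply, map_sub, hv]
      module
    apply le_antisymm
    · rw [Submodule.map_le_iff_le_comap]
      refine Submodule.span_le.2 ?_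
      rintro _ ⟨k, hk, j, rfl⟩
      rw [SetLike.mem_coe, Submodule.mem_comap, key]
      exact Submodule.sub_mem _ (smul_e_mem p c t i _ j) (smul_e_mem p c t i _ j)
    · refine Submodule.span_le.2 ?_
      rintro _ ⟨k, hk, j, rfl⟩
      have h1 := Submodule.mem_map_of_mem
        (f := G' - t i • (LinearMap.id : V p c →ₗ[ℝ] V p c)) (e_sub_mem' p c k i j)
      rw [key, sub_self (t i), zero_smul, sub_zero] at h1
      have hne : t k - t i ≠ 0 := sub_ne_zero.2 fun h => hk (ht h)
      exact (Submodule.smul_mem_iff _ hne).1 h1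
end
end

section
/- There exists an invertible linear map G' : V → V satisfying (G' − t_i·Id)(F_{p+1}) = F_i for every i = 1, …, p. -/
noncomputable section

/-- The modified diagonal map. -/
def Gmod (p c : ℕ) (t : Fin (p + 2) → ℝ) : V p c →ₗ[ℝ] V p c where
  toFun x q := t q.1 * x q + if t q.1 = 0 then ∑ k, x (k, q.2) else 0
  map_add' x y := by
    ext q
    simp only [Pi.add_apply, Finset.sum_add_distrib]
    split_ifs <;> ring
  map_smul' a x := by
    ext q
    simp only [Pi.smul_apply, smul_eq_mul, ← Finset.mul_sum, RingHom.id_apply]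
    split_ifs <;> ring

lemma sum_e (p c : ℕ) (k : Fin (p + 2)) (j j' : Fin (c + 1)) :
    ∑ l, e p c k j (l, j') = if j' = j then 1 else 0 := by
  simp [e, Pi.single_apply, Prod.ext_iff, ite_and]

lemma Gmod_diff (p c : ℕ) (t : Fin (p + 2) → ℝ) (l k : Fin (p + 2)) (j : Fin (c + 1)) :
    Gmod p c t (e p c l j - e p c k j) = t l • e p c l j - t k • e p c k j := by
  ext q
  obtain ⟨a, b⟩ := q
  have h : ∀ l : Fin (p + 2), t a * e p c l j (a, b) = t l * e p c l j (a, b) := by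
    intro l
    by_cases hl : a = l
    · rw [hl]
    · simp [e, Pi.single_apply, hl]
  simp only [Gmod, LinearMap.coe_mk, AddHom.coe_mk, Pi.sub_apply, Finset.sum_sub_distrib, sum_e,
    sub_self, ite_self, add_zero, Pi.smul_apply, smul_eq_mul, mul_sub, h]

lemma Gmod_inj (p c : ℕ) (t : Fin (p + 2) → ℝ) (ht : Function.Injective t) :
    Function.Injective (Gmod p c t) := by
  rw [injective_iff_map_eq_zero]
  intro x hx
  have h : ∀ a b, t a * x (a, b) + (if t a = 0 then ∑ k, x (k, b) else 0) = 0 :=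
    fun a b => congrFun hx (a, b)
  have h1 : ∀ a b, t a ≠ 0 → x (a, b) = 0 := by
    intro a b ha
    have := h a b
    simpa [ha] using this
  ext ⟨a, b⟩
  by_cases ha : t a = 0
  · have h2 := h a b
    rw [if_pos ha, ha, zero_mul, zero_add, Finset.sum_eq_single a] at h2
    · exact h2
    · intro k _ hk
      exact h1 k b fun h0 => hk (ht (h0.trans ha.symm))
    · simp
  · exact h1 a b ha

/-- there exists an invertible linear map `G'` with
`(G' − t_i·Id)(F_{p+1}) = F_i` for every `i = 1, …, p`. -/
theorem exists_invertible_interpolating_map (p c : ℕ) (t : Fin (p + 2) → ℝ)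
    (ht : Function.Injective t) :
    ∃ G' : V p c →ₗ[ℝ] V p c, Function.Bijective G' ∧
      ∀ i : Fin (p + 2),
        (Flast p c).map (G' - t i • (LinearMap.id : V p c →ₗ[ℝ] V p c)) = Fsub p c i := by
  refine ⟨Gmod p c t, ⟨Gmod_inj p c t ht,
    LinearMap.injective_iff_surjective.mp (Gmod_inj p c t ht)⟩, fun i => ?_⟩
  have key : ∀ k j, (Gmod p c t - t i • (LinearMap.id : V p c →ₗ[ℝ] V p c))
      (e p c (lastB p) j - e p c k j) =
      (t (lastB p) - t i) • e p c (lastB p) j - (t k - t i) • e p c k j := by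
    intro k j
    rw [LinearMap.sub_apply, Gmod_diff, LinearMap.smul_apply, LinearMap.id_apply]
    module
  have memF : ∀ k j, (t k - t i) • e p c k j ∈ Fsub p c i := by
    intro k j
    by_cases hk : k = i
    · simp [hk]
    · exact Submodule.smul_mem _ _ (Submodule.subset_span ⟨k, hk, j, rfl⟩)
  apply le_antisymm
  · rw [Flast, Submodule.map_span_le]
    rintro _ ⟨k, hk, j, rfl⟩
    rw [key]
    exact Submodule.sub_mem _ (memF _ _) (memF _ _)
  · set M := (Flast p c).map (Gmod p c t - t i • (LinearMap.id : V p c →ₗ[ℝ] V p c)) with hM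
    have memM : ∀ k j, k ≠ lastB p →
        (t (lastB p) - t i) • e p c (lastB p) j - (t k - t i) • e p c k j ∈ M := by
      intro k j hk
      rw [← key]
      exact Submodule.mem_map_of_mem (Submodule.subset_span ⟨k, hk, j, rfl⟩)
    have memL : ∀ j, (t (lastB p) - t i) • e p c (lastB p) j ∈ M := by
      intro j
      by_cases hi : i = lastB p
      · simp [hi]
      · simpa using memM i j hi
    rw [Fsub, Submodule.span_le]
    rintro _ ⟨k, hk, j, rfl⟩
    have hne : t k - t i ≠ 0 := sub_ne_zero.mpr fun h => hk (ht h)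
    refine (Submodule.smul_mem_iff M hne).mp ?_
    by_cases hl : k = lastB p
    · rw [hl]
      exact memL j
    · have := Submodule.sub_mem _ (memL j) (memM k j hl)
      rwa [sub_sub_cancel] at this
end
end

section
/- Fix pairwise distinct real numbers t_1, …, t_p and for s ∈ ℝ set β(s) = span{(t_p − s)e_p^j − (t_k − s)e_k^j : k = 1, …, p−1, j = 1, …, c}. Then for any pairwise distinct real numbers s_1, …, s_p one has ⋂_{r=1}^p β(s_r) = {0}. -/
noncomputable section

lemma pencil_functional (p c : ℕ) (t : Fin (p + 2) → ℝ) (s : ℝ) (v : V p c)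
    (hv : v ∈ pencil p c t s) (j : Fin (c + 1)) :
    ∑ i, v (i, j) * ∏ l ∈ Finset.univ.erase i, (t l - s) = 0 := by
  unfold pencil at hv
  induction hv using Submodule.span_induction with
  | mem x hx =>
    obtain ⟨k, hk, j', rfl⟩ := hx
    by_cases hj : j = j'
    · subst hj
      have h1 : ∀ a : Fin (p + 2), (t a - s) * ∏ l ∈ Finset.univ.erase a, (t l - s)
          = ∏ l, (t l - s) := fun a =>
        Finset.mul_prod_erase Finset.univ (fun l => t l - s) (Finset.mem_univ a)
      have h2 : ∀ a i : Fin (p + 2), e p c a j (i, j) = if i = a then 1 else 0 := by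
        intro a i
        simp [e, Pi.single_apply]
      simp only [Pi.sub_apply, Pi.smul_apply, h2, smul_eq_mul, sub_mul, Finset.sum_sub_distrib]
      simp only [mul_ite, mul_one, mul_zero, ite_mul, zero_mul, Finset.sum_ite_eq',
        Finset.mem_univ, if_true, ← sub_mul, Finset.sum_sub_distrib]
      simp [← sub_mul, h1]
    · simp [e, Pi.single_apply, hj]
  | zero => simp
  | add x y _ _ hx hy => simp [add_mul, Finset.sum_add_distrib, hx, hy]
  | smul a x _ hx => simp [mul_assoc, ← Finset.mul_sum, hx]

/-- for pairwise distinct parameters `s_1, …, s_p`, the corresponding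
members of the pencil intersect trivially: `⋂_{r=1}^p β(s_r) = {0}`. -/
theorem pencil_members_inf_bot (p c : ℕ) (t : Fin (p + 2) → ℝ)
    (ht : Function.Injective t)
    (s : Fin (p + 2) → ℝ) (hs : Function.Injective s) :
    ⨅ r : Fin (p + 2), pencil p c t (s r) = ⊥ := by
  rw [eq_bot_iff]
  intro v hv
  rw [Submodule.mem_iInf] at hv
  rw [Submodule.mem_bot]
  ext ⟨i, j⟩
  let P : Polynomial ℝ := ∑ i, Polynomial.C (v (i, j)) *
    ∏ l ∈ Finset.univ.erase i, (Polynomial.C (t l) - Polynomial.X)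
  have hev : ∀ x, P.eval x = ∑ i, v (i, j) * ∏ l ∈ Finset.univ.erase i, (t l - x) := by
    intro x
    simp [P, Polynomial.eval_finset_sum, Polynomial.eval_prod]
  have hdeg : P.natDegree < p + 2 := by
    refine Nat.lt_succ_of_le (Polynomial.natDegree_sum_le_of_forall_le _ _ fun i _ => ?_)
    refine (Polynomial.natDegree_C_mul_le _ _).trans ((Polynomial.natDegree_prod_le _ _).trans ?_)
    refine (Finset.sum_le_card_nsmul _ _ 1 fun l _ => ?_).trans ?_
    · exact (Polynomial.natDegree_sub_le _ _).trans (by simp)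
    · simp
  have hP : P = 0 := Polynomial.eq_zero_of_natDegree_lt_card_of_eval_eq_zero P hs
    (fun r => by rw [hev]; exact pencil_functional p c t (s r) v (hv r) j) (by simpa using hdeg)
  have h := hev (t i)
  rw [hP, Polynomial.eval_zero, Finset.sum_eq_single i] at h
  · rcases mul_eq_zero.1 h.symm with h | h
    · simpa using h
    · obtain ⟨l, hl, h⟩ := Finset.prod_eq_zero_iff.1 h
      exact absurd (ht (sub_eq_zero.1 h)) (Finset.ne_of_mem_erase hl)
  · intro b _ hb
    rw [Finset.prod_eq_zero (i := i) (by simp [hb.symm]) (sub_self _), mul_zero]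
  · simp
end
end

section
/- Fix pairwise distinct real numbers t_1, …, t_p. For t ∈ ℝ and j = 1, …, c set w^j(t) = Σ_{i=1}^p (Π_{l ≠ i}(t_l − t)) e_i^j ∈ V. Then for every t ∈ ℝ, the subspace {v ∈ V : ((t_p − t)x_p^j − (t_k − t)x_k^j)(v) = 0 for all k = 1, …, p−1 and j = 1, …, c} equals span{w^1(t), …, w^c(t)}. -/
noncomputable section

/-- `w^j(t) = Σ_{i=1}^p (Π_{l ≠ i}(t_l − t)) e_i^j`. -/
def w (p c : ℕ) (t : Fin (p + 2) → ℝ) (s : ℝ) (j : Fin (c + 1)) : V p c :=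
  ∑ i : Fin (p + 2), (∏ l ∈ Finset.univ.erase i, (t l - s)) • e p c i j

theorem w_apply_aux (p c : ℕ) (t : Fin (p + 2) → ℝ) (s : ℝ) (j : Fin (c + 1))
    (k : Fin (p + 2)) (j' : Fin (c + 1)) :
    w p c t s j (k, j') = if j' = j then ∏ l ∈ Finset.univ.erase k, (t l - s) else 0 := by
  simp only [w, e, Finset.sum_apply, Pi.smul_apply, Pi.single_apply, Prod.mk.injEq, smul_eq_mul]
  by_cases h : j' = j
  · simp [h]
  · simp [h]

/-- the annihilator in `V` of the covectors
`(t_p − t)x_p^j − (t_k − t)x_k^j` is exactly `span{w^1(t), …, w^c(t)}`. -/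
theorem veronese_interpolation_annihilator (p c : ℕ) (t : Fin (p + 2) → ℝ)
    (ht : Function.Injective t) :
    ∀ s : ℝ,
      {v : V p c | ∀ k, k ≠ lastB p → ∀ j,
          (t (lastB p) - s) * v (lastB p, j) - (t k - s) * v (k, j) = 0} =
        ↑(Submodule.span ℝ (Set.range (w p c t s))) := by
  intro s
  have hP : ∀ i, (t i - s) * ∏ l ∈ Finset.univ.erase i, (t l - s) = ∏ l, (t l - s) :=
    fun i => Finset.mul_prod_erase Finset.univ (fun l => t l - s) (Finset.mem_univ i)
  ext v
  simp only [Set.mem_setOf_eq, SetLike.mem_coe]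
  rw [Submodule.mem_span_range_iff_exists_fun]
  have hsum : ∀ (μ : Fin (c + 1) → ℝ) k j, (∑ i, μ i • w p c t s i) (k, j) =
      μ j * ∏ l ∈ Finset.univ.erase k, (t l - s) := by
    intro μ k j
    simp [Finset.sum_apply, w_apply_aux]
  constructor
  · intro h
    obtain ⟨m, hm⟩ : ∃ m, ∀ l, l ≠ m → t l - s ≠ 0 := by
      by_cases hs : ∃ m, t m = s
      · obtain ⟨m, hm⟩ := hs
        exact ⟨m, fun l hl h0 => hl (ht (by linarith))⟩
      · exact ⟨0, fun l _ h0 => hs ⟨l, by linarith⟩⟩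
    have hall : ∀ k j, (t k - s) * v (k, j) = (t (lastB p) - s) * v (lastB p, j) := by
      intro k j
      by_cases hk : k = lastB p
      · rw [hk]
      · linarith [h k hk j]
    have hPm : ∏ l ∈ Finset.univ.erase m, (t l - s) ≠ 0 :=
      Finset.prod_ne_zero_iff.mpr fun l hl => hm l (Finset.ne_of_mem_erase hl)
    refine ⟨fun j => v (m, j) / ∏ l ∈ Finset.univ.erase m, (t l - s), ?_⟩
    ext ⟨i, j⟩
    rw [hsum, div_mul_eq_mul_div, div_eq_iff hPm]
    by_cases hi : i = m
    · rw [hi]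
    · apply mul_left_cancel₀ (hm i hi)
      have h1 := hP i
      have h2 := hP m
      have h3 := (hall i j).trans (hall m j).symm
      linear_combination v (m, j) * (h1 - h2) - (∏ l ∈ Finset.univ.erase m, (t l - s)) * h3
  · rintro ⟨μ, rfl⟩ k _ j
    rw [hsum, hsum]
    linear_combination μ j * (hP (lastB p) - hP k)
end
end
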